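/- Let P be a finite nonempty subset of a metric space M, let k, ℓ be integers with 1 ≤ ℓ ≤ k ≤ |P|, and set m = ⌊k/ℓ⌋. Let c ≥ 0 be a real number and let Q ⊆ P with |Q| = m be a c-approximate m-center solution, i.e. max_{p ∈ P} dist_1(Q, p) ≤ c·r_cen. Suppose C ⊆ P is obtained by choosing, for each q ∈ Q, a set N_q of exactly ℓ points of P each within distance dist_ℓ(P, q) of q, and taking C = ∪_{q ∈ Q} N_q. Then |C| ≤ k and max_{p ∈ P} dist_ℓ(C, p) ≤ (1 + 2c)·r_opt. -/

import Mathlib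

/-- `kthDist S p i` is the `i`-th smallest value (1-indexed) among the distances
`dist p s` for `s ∈ S`, i.e. the radius of the smallest closed ball centered at `p`
containing at least `i` points of `S`. -/
noncomputable def kthDist {M : Type*} [MetricSpace M] (S : Finset M) (p : M) (i : ℕ) : ℝ :=
  ((S.val.map (fun s => dist p s)).sort (· ≤ ·)).getD (i - 1) 0

theorem List.getD_le_iff_lt_countP_of_pairwise {l : List ℝ} (hl : l.Pairwise (· ≤ ·))
    {i : ℕ} (hi : i < l.length) (r : ℝ) :
    l.getD i 0 ≤ r ↔ i < l.countP (fun x => x ≤ r) := by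
  induction l generalizing i with
  | nil => simp at hi
  | cons a t ih =>
    rw [List.pairwise_cons] at hl
    by_cases har : a ≤ r
    · cases i with
      | zero => simp [har]
      | succ j =>
        have := ih hl.2 (i := j) (by simpa using hi)
        simpa [har, List.countP_cons] using this
    · have hgt : ∀ x ∈ a :: t, r < x := by
        intro x hx
        rcases List.mem_cons.1 hx with rfl | hx
        · exact not_le.1 har
        · exact (not_le.1 har).trans_le (hl.1 x hx)
      have hzero : (a :: t).countP (fun x => x ≤ r) = 0 := by
        rw [List.countP_eq_zero]
        intro x hx
        simpa using hgt x hx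
      rw [hzero, List.getD_eq_getElem _ _ hi]
      simpa using hgt _ (List.getElem_mem hi)

theorem kthDist_le_iff {M : Type*} [MetricSpace M] {S : Finset M} {p : M} {i : ℕ}
    (hi : 1 ≤ i) (hiS : i ≤ S.card) (r : ℝ) :
    kthDist S p i ≤ r ↔ i ≤ (S.filter (fun s => dist p s ≤ r)).card := by
  have hcount : ((S.val.map (fun s => dist p s)).sort (· ≤ ·)).countP (fun x => x ≤ r) =
      (S.filter (fun s => dist p s ≤ r)).card := by
    rw [← Multiset.coe_countP, Multiset.sort_eq, Multiset.countP_map]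
    rfl
  rw [kthDist, List.getD_le_iff_lt_countP_of_pairwise (Multiset.pairwise_sort _ _)
    (by rw [Multiset.length_sort, Multiset.card_map, Finset.card_val]; omega), hcount]
  omega

/-- A maximal `2 * r`-separated subset of `P` covers `P` with radius `2 * r`, and has at most
`C.card / ℓ` points when every ball of radius `r` around a point of `P` holds `ℓ` points of `C`. -/
theorem exists_cover_card_mul_le {M : Type*} [MetricSpace M]
    {P C : Finset M} {ℓ : ℕ} {r : ℝ} (hr : 0 ≤ r)
    (hC : ∀ p ∈ P, ℓ ≤ (C.filter (fun s => dist p s ≤ r)).card) :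
    ∃ S ⊆ P, S.card * ℓ ≤ C.card ∧ ∀ p ∈ P, ∃ s ∈ S, dist p s ≤ 2 * r := by
  classical
  obtain ⟨S, hS, hmax⟩ := Finset.exists_max_image
    (P.powerset.filter fun S : Finset M => (S : Set M).Pairwise fun x y => 2 * r < dist x y)
    Finset.card ⟨∅, by simp⟩
  rw [Finset.mem_filter, Finset.mem_powerset] at hS
  obtain ⟨hSP, hsep⟩ := hS
  refine ⟨S, hSP, ?_, ?_⟩
  · have hdisj : (S : Set M).PairwiseDisjoint fun p => C.filter (fun s => dist p s ≤ r) := by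
      intro x hx y hy hxy
      refine Finset.disjoint_left.2 fun z hzx hzy => ?_
      have h₁ := (Finset.mem_filter.1 hzx).2
      have h₂ := (Finset.mem_filter.1 hzy).2
      have := dist_triangle_right x y z
      linarith [hsep hx hy hxy]
    calc S.card * ℓ ≤ ∑ p ∈ S, (C.filter (fun s => dist p s ≤ r)).card := by
          simpa using Finset.card_nsmul_le_sum S _ ℓ fun p hp => hC p (hSP hp)
      _ = (S.biUnion fun p => C.filter (fun s => dist p s ≤ r)).card :=
          (Finset.card_biUnion hdisj).symm
      _ ≤ C.card := Finset.card_le_card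
          (Finset.biUnion_subset.2 fun p _ => Finset.filter_subset _ _)
  · intro p hp
    by_contra! hfar
    have hpS : p ∉ S := fun h => by
      have := hfar p h
      rw [dist_self] at this
      linarith
    have hins := hmax (insert p S) <| by
      rw [Finset.mem_filter, Finset.mem_powerset, Finset.coe_insert]
      refine ⟨Finset.insert_subset hp hSP, hsep.insert fun y hy _ => ⟨hfar y hy, ?_⟩⟩
      rw [dist_comm]
      exact hfar y hy
    rw [Finset.card_insert_of_notMem hpS] at hins
    omega

/-- Let `P` be a finite nonempty subset of a metric space,
`1 ≤ ℓ ≤ k ≤ |P|`, `m = ⌊k/ℓ⌋`.  Let `c ≥ 0` and `Q ⊆ P` with `|Q| = m` be a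
`c`-approximate `m`-center solution, i.e. `max_{p ∈ P} dist_1(Q, p) ≤ c·r_cen`.
Suppose `C ⊆ P` is obtained by choosing, for each `q ∈ Q`, a set `N q` of exactly `ℓ`
points of `P` each within distance `dist_ℓ(P, q)` of `q`, and taking `C = ⋃_{q ∈ Q} N q`.
Then `|C| ≤ k` and `max_{p ∈ P} dist_ℓ(C, p) ≤ (1 + 2c)·r_opt`. -/
theorem faultTolerant_kCenter_approx {M : Type*} [MetricSpace M] [DecidableEq M]
    (P : Finset M) (hP : P.Nonempty) (k ℓ : ℕ)
    (hl1 : 1 ≤ ℓ) (hlk : ℓ ≤ k) (hkP : k ≤ P.card)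
    (ropt rcen : ℝ)
    (hopt : IsLeast {x : ℝ | ∃ C : Finset M, C ⊆ P ∧ C.card = k ∧
      x = P.sup' hP (fun p => kthDist C p ℓ)} ropt)
    (hcen : IsLeast {x : ℝ | ∃ Q : Finset M, Q ⊆ P ∧ Q.card = k / ℓ ∧
      x = P.sup' hP (fun p => kthDist Q p 1)} rcen)
    (c : ℝ) (hc : 0 ≤ c)
    (Q : Finset M) (hQP : Q ⊆ P) (hQcard : Q.card = k / ℓ)
    (hQapprox : P.sup' hP (fun p => kthDist Q p 1) ≤ c * rcen)
    (N : M → Finset M)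
    (hN : ∀ q ∈ Q, N q ⊆ P ∧ (N q).card = ℓ ∧ ∀ x ∈ N q, dist q x ≤ kthDist P q ℓ)
    (C : Finset M) (hC : C = Q.biUnion N) :
    C.card ≤ k ∧ P.sup' hP (fun p => kthDist C p ℓ) ≤ (1 + 2 * c) * ropt := by
  subst hC
  obtain ⟨⟨O, hOP, hOcard, hO⟩, -⟩ := hopt
  have hm : 1 ≤ k / ℓ := (Nat.one_le_div_iff (by omega)).2 hlk
  have hball : ∀ p ∈ P, ℓ ≤ (O.filter (fun s => dist p s ≤ ropt)).card := by
    intro p hp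
    rw [← kthDist_le_iff hl1 (by omega), hO]
    exact Finset.le_sup' (fun p => kthDist O p ℓ) hp
  have hropt : 0 ≤ ropt := by
    obtain ⟨p, hp⟩ := hP
    obtain ⟨s, hs⟩ := Finset.card_pos.1 (hl1.trans (hball p hp))
    exact dist_nonneg.trans (Finset.mem_filter.1 hs).2
  have hrcen : rcen ≤ 2 * ropt := by
    obtain ⟨S, hSP, hScard, hS⟩ := exists_cover_card_mul_le hropt hball
    obtain ⟨T, hST, hTP, hTcard⟩ := Finset.exists_subsuperset_card_eq hSP
      ((Nat.le_div_iff_mul_le (by omega)).2 (hOcard ▸ hScard))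
      ((Nat.div_le_self k ℓ).trans hkP)
    refine (hcen.2 ⟨T, hTP, hTcard, rfl⟩).trans (Finset.sup'_le _ _ fun p hp => ?_)
    obtain ⟨s, hs, hps⟩ := hS p hp
    change kthDist T p 1 ≤ 2 * ropt
    rw [kthDist_le_iff le_rfl (by omega)]
    exact Finset.card_pos.2 ⟨s, Finset.mem_filter.2 ⟨hST hs, hps⟩⟩
  have hNdist : ∀ q ∈ Q, ∀ x ∈ N q, dist q x ≤ ropt := by
    intro q hq x hx
    refine ((hN q hq).2.2 x hx).trans ?_
    rw [kthDist_le_iff hl1 (hlk.trans hkP)]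
    exact (hball q (hQP hq)).trans (Finset.card_le_card (Finset.filter_subset_filter _ hOP))
  refine ⟨?_, Finset.sup'_le _ _ fun p hp => ?_⟩
  · calc (Q.biUnion N).card ≤ Q.card * ℓ :=
          Finset.card_biUnion_le_card_mul _ _ _ fun q hq => (hN q hq).2.1.le
      _ ≤ k := hQcard ▸ Nat.div_mul_le_self k ℓ
  · have hpQ : kthDist Q p 1 ≤ c * rcen :=
      (Finset.le_sup' (fun p => kthDist Q p 1) hp).trans hQapprox
    rw [kthDist_le_iff le_rfl (by omega)] at hpQ
    obtain ⟨q, hq⟩ := Finset.card_pos.1 hpQ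
    obtain ⟨hq, hpq⟩ := Finset.mem_filter.1 hq
    have hNsub : N q ⊆ Q.biUnion N := Finset.subset_biUnion_of_mem N hq
    have hNcard := (hN q hq).2.1
    change kthDist (Q.biUnion N) p ℓ ≤ _
    rw [kthDist_le_iff hl1 (hNcard ▸ Finset.card_le_card hNsub)]
    refine hNcard.symm.le.trans ?_
    refine Finset.card_le_card fun x hx => Finset.mem_filter.2 ⟨hNsub hx, ?_⟩
    calc dist p x ≤ dist p q + dist q x := dist_triangle p q x
      _ ≤ c * (2 * ropt) + ropt :=
          add_le_add (hpq.trans (mul_le_mul_of_nonneg_left hrcen hc)) (hNdist q hq x hx)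
      _ = (1 + 2 * c) * ropt := by ring
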